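/- Let q be a prime power and S a surface of degree d in P^3 over F_q without F_q-plane components, with 2 ≤ d ≤ q+1 and N_q(S) = (d-1)q^2 + dq + 1. Then S contains a line defined over F_q, i.e., the defining form of S vanishes identically on some F_q-line of P^3. -/

import Mathlib

open MvPolynomial

variable {K : Type} [Field K]

/-- The linear form `∑ aᵢ Xᵢ` as a multivariate polynomial. -/
noncomputable def linForm {n : ℕ} (a : Fin n → K) : MvPolynomial (Fin n) K :=
  ∑ i, C (a i) * X i

/-- The linear form `v ↦ ∑ aᵢ vᵢ` as a linear map. -/
noncomputable def linMap {n : ℕ} (a : Fin n → K) : (Fin n → K) →ₗ[K] K :=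
  ∑ i, a i • LinearMap.proj i

/-- Substitution `F(M·X)` of a linear change of variables into `F`. -/
noncomputable def substLin {n : ℕ} (M : Matrix (Fin n) (Fin n) K)
    (F : MvPolynomial (Fin n) K) : MvPolynomial (Fin n) K :=
  MvPolynomial.aeval (fun i => ∑ j, C (M i j) * X j) F

/-- Projective equivalence over `K` of two forms. -/
def ProjEquiv {n : ℕ} (F G : MvPolynomial (Fin n) K) : Prop :=
  ∃ M : Matrix (Fin n) (Fin n) K, IsUnit M.det ∧
    ∃ c : K, c ≠ 0 ∧ substLin M F = C c * G

/-- An `F_q`-line in `P^3` (resp. `P^2`), as a 2-dimensional linear subspace. -/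
def IsLine {n : ℕ} (W : Submodule K (Fin n → K)) : Prop := Module.finrank K W = 2

/-- An `F_q`-plane in `P^3`, as a 3-dimensional linear subspace. -/
def IsPlane (W : Submodule K (Fin 4 → K)) : Prop := Module.finrank K W = 3

/-- The section `S ∩ H` of the surface `S = {F = 0}` with the plane `H` given by the
subspace `W` is a planar `F_q`-pencil of degree `d` with vertex `P`: modulo the linear
form defining `H`, `F` is a nonzero scalar times a product of `d` linear forms over `F_q`
cutting out `d` pairwise distinct lines of `H`, all passing through the point `P`. -/
def IsPencil (F : MvPolynomial (Fin 4) K) (d : ℕ)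
    (W : Submodule K (Fin 4 → K)) (P : Projectivization K (Fin 4 → K)) : Prop :=
  ∃ (a : Fin 4 → K) (m : Fin d → Fin 4 → K) (c : K) (g : MvPolynomial (Fin 4) K),
    a ≠ 0 ∧ W = LinearMap.ker (linMap a) ∧ c ≠ 0 ∧
    F = C c * (∏ i, linForm (m i)) + linForm a * g ∧
    (∀ i, IsLine (LinearMap.ker (linMap a) ⊓ LinearMap.ker (linMap (m i)))) ∧
    (∀ i j, i ≠ j →
      LinearMap.ker (linMap a) ⊓ LinearMap.ker (linMap (m i)) ≠
      LinearMap.ker (linMap a) ⊓ LinearMap.ker (linMap (m j))) ∧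
    P.rep ∈ W ∧ (∀ i, linMap (m i) P.rep = 0)

/-- The restriction of `F` to the plane `H` given by the subspace `W` has a linear
factor over `F_q` (i.e. the section `S ∩ H` has an `F_q`-line component). -/
def SectionHasLineComp (F : MvPolynomial (Fin 4) K)
    (W : Submodule K (Fin 4 → K)) : Prop :=
  ∃ (a b : Fin 4 → K) (h g : MvPolynomial (Fin 4) K),
    a ≠ 0 ∧ W = LinearMap.ker (linMap a) ∧
    IsLine (LinearMap.ker (linMap a) ⊓ LinearMap.ker (linMap b)) ∧
    F = linForm b * h + linForm a * g

/-- The restriction of `F` to the parametrized affine line `t ↦ v + t p`. -/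
noncomputable def lineRestriction {K : Type} [Field K] (F : MvPolynomial (Fin 4) K)
    (v p : Fin 4 → K) : Polynomial K :=
  MvPolynomial.aeval (fun i => Polynomial.C (v i) + Polynomial.C (p i) * Polynomial.X) F

theorem eval_lineRestriction {K : Type} [Field K] (F : MvPolynomial (Fin 4) K)
    (v p : Fin 4 → K) (t : K) :
    (lineRestriction F v p).eval t = MvPolynomial.eval (v + t • p) F := by
  have h : (Polynomial.aeval t).comp (MvPolynomial.aeval (R := K) fun i =>
      Polynomial.C (v i) + Polynomial.C (p i) * Polynomial.X) =
      MvPolynomial.aeval (v + t • p) := by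
    refine MvPolynomial.algHom_ext fun i => ?_
    simp only [AlgHom.comp_apply, MvPolynomial.aeval_X, map_add, map_mul, Polynomial.aeval_C,
      Polynomial.aeval_X, Pi.add_apply, Pi.smul_apply, smul_eq_mul]
    rw [mul_comm]
    rfl
  have := DFunLike.congr_fun h F
  rwa [AlgHom.comp_apply, Polynomial.coe_aeval_eq_eval, MvPolynomial.aeval_eq_eval] at this

theorem natDegree_linear_pow_le {K : Type} [Field K] (a b : K) (n : ℕ) :
    ((Polynomial.C a + Polynomial.C b * Polynomial.X) ^ n).natDegree ≤ n := by
  refine (Polynomial.natDegree_pow_le_of_le n (m := 1) ?_).trans (by simp)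
  compute_degree

theorem coeff_linear_pow {K : Type} [Field K] (a b : K) (n : ℕ) :
    ((Polynomial.C a + Polynomial.C b * Polynomial.X) ^ n).coeff n = b ^ n := by
  have h := Polynomial.coeff_pow_of_natDegree_le (m := n)
    (p := Polynomial.C a + Polynomial.C b * Polynomial.X) (n := 1) (by compute_degree)
  simpa [Polynomial.coeff_C] using h

/-- The restriction of a form of degree `d` to an affine line has degree at most `d`, and its
coefficient in degree `d` is the value of the form at the direction of the line. -/
theorem lineRestriction_natDegree_coeff {K : Type} [Field K] {d : ℕ}
    {F : MvPolynomial (Fin 4) K} (hF : F.IsHomogeneous d) (v p : Fin 4 → K) :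
    (lineRestriction F v p).natDegree ≤ d ∧
      (lineRestriction F v p).coeff d = MvPolynomial.eval p F := by
  have hdeg : ∀ m ∈ F.support, m 0 + m 1 + m 2 + m 3 = d := by
    intro m hm
    have := hF (MvPolynomial.mem_support_iff.mp hm)
    rw [Finsupp.weight_apply, Finsupp.sum_fintype _ _ (by simp)] at this
    simpa [Fin.sum_univ_four] using this
  unfold lineRestriction
  rw [MvPolynomial.aeval_def, MvPolynomial.eval₂_eq', MvPolynomial.eval_eq',
    Polynomial.finsetSum_coeff]
  constructor
  · refine Polynomial.natDegree_sum_le_of_forall_le _ _ fun m hm => ?_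
    rw [← hdeg m hm, Fin.prod_univ_four]
    refine (Polynomial.natDegree_C_mul_le _ _).trans ?_
    exact Polynomial.natDegree_mul_le_of_le (Polynomial.natDegree_mul_le_of_le
      (Polynomial.natDegree_mul_le_of_le (natDegree_linear_pow_le ..)
        (natDegree_linear_pow_le ..)) (natDegree_linear_pow_le ..)) (natDegree_linear_pow_le ..)
  · refine Finset.sum_congr rfl fun m hm => ?_
    rw [← hdeg m hm, Fin.prod_univ_four, Fin.prod_univ_four]
    have h2 := Polynomial.natDegree_mul_le_of_le (natDegree_linear_pow_le (v 0) (p 0) (m 0))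
      (natDegree_linear_pow_le (v 1) (p 1) (m 1))
    have h3 := Polynomial.natDegree_mul_le_of_le h2 (natDegree_linear_pow_le (v 2) (p 2) (m 2))
    rw [← Polynomial.C_eq_algebraMap, Polynomial.coeff_C_mul,
      Polynomial.coeff_mul_add_eq_of_natDegree_le h3 (natDegree_linear_pow_le ..),
      Polynomial.coeff_mul_add_eq_of_natDegree_le h2 (natDegree_linear_pow_le ..),
      Polynomial.coeff_mul_add_eq_of_natDegree_le (natDegree_linear_pow_le ..)
        (natDegree_linear_pow_le ..)]
    simp only [coeff_linear_pow]

/-- A form of degree `d` vanishing in the direction `p` of an affine line, but not on the whole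
line, has at most `d - 1` zeros on it. -/
theorem card_zeros_on_line_le {K : Type} [Field K] [Fintype K] [DecidableEq K] {d : ℕ}
    {F : MvPolynomial (Fin 4) K} (hF : F.IsHomogeneous d) (hd : 1 ≤ d) {v p : Fin 4 → K}
    (hp : MvPolynomial.eval p F = 0) (hv : ∃ t : K, MvPolynomial.eval (v + t • p) F ≠ 0) :
    (Finset.univ.filter fun t : K => MvPolynomial.eval (v + t • p) F = 0).card ≤ d - 1 := by
  obtain ⟨hle, hco⟩ := lineRestriction_natDegree_coeff hF v p
  obtain ⟨t₀, ht₀⟩ := hv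
  have hne : lineRestriction F v p ≠ 0 := by
    intro h
    rw [← eval_lineRestriction, h] at ht₀
    simp at ht₀
  have hlt : (lineRestriction F v p).natDegree ≤ d - 1 := by
    have : (lineRestriction F v p).natDegree ≠ d := by
      intro h
      apply hne
      rw [← Polynomial.leadingCoeff_eq_zero, Polynomial.leadingCoeff, h, hco, hp]
    omega
  refine (Finset.card_le_card (t := (lineRestriction F v p).roots.toFinset) ?_).trans
    ((Multiset.toFinset_card_le _).trans ((Polynomial.card_roots' _).trans hlt))
  intro t ht
  simpa [hne, eval_lineRestriction] using ht

theorem eval_smul_of_isHomogeneous {K : Type} [Field K] {d : ℕ} {F : MvPolynomial (Fin 4) K}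
    (hF : F.IsHomogeneous d) (c : K) (v : Fin 4 → K) :
    MvPolynomial.eval (c • v) F = c ^ d * MvPolynomial.eval v F := by
  rw [MvPolynomial.eval_eq', MvPolynomial.eval_eq', Finset.mul_sum]
  refine Finset.sum_congr rfl fun m hm => ?_
  have := hF (MvPolynomial.mem_support_iff.mp hm)
  rw [Finsupp.weight_apply, Finsupp.sum_fintype _ _ (by simp)] at this
  simp only [Pi.one_apply, smul_eq_mul, mul_one] at this
  rw [← this, ← Finset.prod_pow_eq_pow_sum]
  simp only [Pi.smul_apply, smul_eq_mul, mul_pow, Finset.prod_mul_distrib]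
  ring

/-- Every projective zero of a form yields `q - 1` nonzero vectors at which it vanishes. -/
theorem card_projective_zeros_mul_le {K : Type} [Field K] [Fintype K] {d : ℕ}
    {F : MvPolynomial (Fin 4) K} (hF : F.IsHomogeneous d) :
    Nat.card {p : Projectivization K (Fin 4 → K) // MvPolynomial.eval p.rep F = 0} *
        (Fintype.card K - 1) ≤
      Nat.card {v : Fin 4 → K // v ≠ 0 ∧ MvPolynomial.eval v F = 0} := by
  classical
  rw [← Fintype.card_units, ← Nat.card_eq_fintype_card (α := Kˣ), ← Nat.card_prod]
  refine Nat.card_le_card_of_injective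
    (fun x => ⟨(x.2 : K) • x.1.1.rep, smul_ne_zero x.2.ne_zero x.1.1.rep_nonzero, by
      rw [eval_smul_of_isHomogeneous hF, x.1.2, mul_zero]⟩) ?_
  rintro ⟨⟨p, hp⟩, u⟩ ⟨⟨p', hp'⟩, u'⟩ h
  have h' : (u : K) • p.rep = (u' : K) • p'.rep := congrArg Subtype.val h
  have hpp : p = p' := by
    rw [← p.mk_rep, ← p'.mk_rep, Projectivization.mk_eq_mk_iff]
    exact ⟨u⁻¹ * u', by rw [mul_smul, inv_smul_eq_iff]; exact h'.symm⟩
  subst hpp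
  have : u = u' := Units.ext (smul_left_injective K p.rep_nonzero h')
  rw [this]

/-- If every line through the zero `p` of a form `F` contains at most `e` further zeros of `F`,
then the zeros of `F` off the span of `p` number at most `e (q³ - 1)`. -/
theorem card_zeros_off_span_mul_le {K : Type} [Field K] [Fintype K] [DecidableEq K]
    (F : MvPolynomial (Fin 4) K) {p : Fin 4 → K} (hp : p ≠ 0) {e : ℕ}
    (he : ∀ v, v ∉ Submodule.span K {p} →
      (Finset.univ.filter fun t : K => MvPolynomial.eval (v + t • p) F = 0).card ≤ e) :
    Fintype.card K * Nat.card {v : Fin 4 → K //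
        v ∉ Submodule.span K {p} ∧ MvPolynomial.eval v F = 0} + Fintype.card K * e ≤
      Fintype.card K ^ 4 * e := by
  classical
  set L := Submodule.span K {p}
  have hL : Fintype.card L = Fintype.card K := by
    rw [Module.card_eq_pow_finrank (K := K), finrank_span_singleton hp, pow_one]
  have hoff : (Finset.univ.filter fun v => v ∉ L).card + Fintype.card K = Fintype.card K ^ 4 := by
    have h := Finset.card_filter_add_card_filter_not (s := (Finset.univ : Finset (Fin 4 → K)))
      (fun v => v ∈ L)
    rw [← Fintype.card_subtype] at h
    have hL' : Fintype.card {v // v ∈ L} = Fintype.card K := by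
      rw [← hL]
    rw [hL', Finset.card_univ, Fintype.card_fun, Fintype.card_fin] at h
    omega
  have hsum : ∑ v ∈ Finset.univ.filter (fun v => v ∉ L),
      (Finset.univ.filter fun t : K => MvPolynomial.eval (v + t • p) F = 0).card =
      Fintype.card K * Nat.card {v // v ∉ L ∧ MvPolynomial.eval v F = 0} := by
    simp_rw [Finset.card_filter]
    rw [Finset.sum_comm, ← smul_eq_mul, ← Finset.card_univ, ← Finset.sum_const]
    refine Finset.sum_congr rfl fun t _ => ?_
    rw [← Finset.card_filter, Finset.filter_filter, Nat.card_eq_fintype_card,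
      Fintype.card_subtype]
    refine Finset.card_bij' (fun v _ => v + t • p) (fun v _ => v - t • p) ?_ ?_ ?_ ?_
    · intro v hv
      have hmem := L.add_mem_iff_left (x := v)
        (L.smul_mem t (Submodule.mem_span_singleton_self p))
      simpa [hmem] using hv
    · intro v hv
      have hmem := L.sub_mem_iff_left (x := v)
        (L.smul_mem t (Submodule.mem_span_singleton_self p))
      simpa [hmem] using hv
    · simp
    · simp
  have := Finset.sum_le_card_nsmul (Finset.univ.filter fun v => v ∉ L) _ e
    fun v hv => he v (Finset.mem_filter.mp hv).2
  rw [hsum, smul_eq_mul] at this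
  rw [← hoff, add_mul]
  omega

/-- A surface of degree `d` (`2 ≤ d ≤ q+1`) in `P^3` over `F_q` without
`F_q`-plane components attaining the elementary bound `N_q(S) = (d-1)q² + dq + 1` contains
an `F_q`-line. -/
theorem extremal_surface_contains_line (K : Type) [Field K] [Fintype K]
    (d : ℕ) (F : MvPolynomial (Fin 4) K)
    (hhom : F.IsHomogeneous d) (hsf : Squarefree F)
    (hnoplane : ¬ ∃ a : Fin 4 → K, a ≠ 0 ∧ linForm a ∣ F)
    (hd2 : 2 ≤ d) (hdq : d ≤ Fintype.card K + 1)
    (hN : Nat.card {p : Projectivization K (Fin 4 → K) // MvPolynomial.eval p.rep F = 0} =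
      (d - 1) * Fintype.card K ^ 2 + d * Fintype.card K + 1) :
    ∃ l : Submodule K (Fin 4 → K), IsLine l ∧
      ∀ v ∈ l, MvPolynomial.eval v F = 0 := by
    classical
  by_contra hno
  have hq : 1 < Fintype.card K := Fintype.one_lt_card
  have hpos : 0 < Nat.card
      {p : Projectivization K (Fin 4 → K) // MvPolynomial.eval p.rep F = 0} := by
    rw [hN]; omega
  obtain ⟨⟨P, hP⟩⟩ := (Nat.card_pos_iff.mp hpos).1
  set p := P.rep
  have hp0 : p ≠ 0 := P.rep_nonzero
  have hnonzero : ∀ v, v ∉ Submodule.span K {p} →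
      ∃ t : K, MvPolynomial.eval (v + t • p) F ≠ 0 := by
    intro v hv
    by_contra! hall
    refine hno ⟨Submodule.span K {v, p}, ?_, ?_⟩
    · have hli : LinearIndependent K ![p, v] := by
        rw [LinearIndependent.pair_iff' hp0]
        exact fun a ha => hv (Submodule.mem_span_singleton.mpr ⟨a, ha⟩)
      have := finrank_span_eq_card hli
      rw [Matrix.range_cons_cons_empty, Set.pair_comm] at this
      simpa [IsLine] using this
    · intro w hw
      obtain ⟨a, b, rfl⟩ := Submodule.mem_span_pair.mp hw
      rcases eq_or_ne a 0 with rfl | ha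
      · rw [zero_smul, zero_add, eval_smul_of_isHomogeneous hhom, hP, mul_zero]
      · have : a • v + b • p = a • (v + (a⁻¹ * b) • p) := by
          rw [smul_add, smul_smul, mul_inv_cancel_left₀ ha]
        rw [this, eval_smul_of_isHomogeneous hhom, hall, mul_zero]
  have hbound := card_zeros_off_span_mul_le F hp0 (e := min (d - 1) (Fintype.card K - 1))
    fun v hv => by
      refine le_min (card_zeros_on_line_le hhom (by omega) hP (hnonzero v hv)) ?_
      obtain ⟨t, ht⟩ := hnonzero v hv
      have := Finset.card_lt_univ_of_notMem (x := t)
        (s := Finset.univ.filter fun t : K => MvPolynomial.eval (v + t • p) F = 0) (by simpa using ht)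
      omega
  have hsplit : Nat.card {v : Fin 4 → K // v ≠ 0 ∧ MvPolynomial.eval v F = 0} + 1 ≤
      Nat.card {v : Fin 4 → K // v ∉ Submodule.span K {p} ∧ MvPolynomial.eval v F = 0} +
        Fintype.card K := by
    have hL : Fintype.card (Submodule.span K {p}) = Fintype.card K := by
      rw [Module.card_eq_pow_finrank (K := K), finrank_span_singleton hp0, pow_one]
    rw [← hL, Nat.card_eq_fintype_card, Nat.card_eq_fintype_card, Fintype.card_subtype,
      Fintype.card_subtype]
    have hL' : Fintype.card (Submodule.span K {p}) =
        (Finset.univ.filter fun v => v ∈ Submodule.span K {p}).card := Fintype.card_subtype _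
    rw [hL', ← Finset.card_insert_of_notMem (a := (0 : Fin 4 → K)) (by simp)]
    refine (Finset.card_le_card ?_).trans (Finset.card_union_le _ _)
    intro v hv
    simp only [Finset.mem_insert, Finset.mem_filter, Finset.mem_univ, true_and,
      Finset.mem_union] at hv ⊢
    rcases hv with rfl | ⟨_, hv⟩
    · exact Or.inr (zero_mem _)
    · tauto
  have hmul := card_projective_zeros_mul_le hhom
  rw [hN] at hmul
  generalize Nat.card {v : Fin 4 → K // v ≠ 0 ∧ MvPolynomial.eval v F = 0} = A at *
  generalize Nat.card {v : Fin 4 → K // v ∉ Submodule.span K {p} ∧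
    MvPolynomial.eval v F = 0} = B at *
  have he1 := min_le_left (d - 1) (Fintype.card K - 1)
  have he2 := min_le_right (d - 1) (Fintype.card K - 1)
  generalize min (d - 1) (Fintype.card K - 1) = e at *
  generalize Fintype.card K = q at *
  obtain ⟨r, rfl⟩ : ∃ r, q = r + 1 := ⟨q - 1, by omega⟩
  obtain ⟨f, rfl⟩ : ∃ f, d = f + 1 := ⟨d - 1, by omega⟩
  simp only [Nat.add_sub_cancel] at *
  have hr : 0 < r := by omega
  have hB : (f * (r + 1) ^ 2 + (f + 1) * (r + 1)) * r ≤ B := by nlinarith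
  have hB' : B ≤ r * ((r + 1) ^ 2 + (r + 1) + 1) * e := by
    refine le_of_mul_le_mul_left (a := r + 1) ?_ (by omega)
    nlinarith
  have hfin : f * (r + 1) ^ 2 + (f + 1) * (r + 1) ≤ ((r + 1) ^ 2 + (r + 1) + 1) * e :=
    le_of_mul_le_mul_left (a := r) (by nlinarith) hr
  have h1 : (r + 1) ^ 2 * e ≤ (r + 1) ^ 2 * f := Nat.mul_le_mul_left _ he1
  have h2 : (r + 1) * e ≤ (r + 1) * f := Nat.mul_le_mul_left _ he1
  nlinarith
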